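/- arXiv:1609.02588 — 8 statements merged into one kernel-verified Lean document; each statement's English description precedes it below -/
import Mathlib

section
/- For every natural number n and all real numbers x and t, the series \(\sum_{n=0}^{\infty} \frac{H_n(x)}{2^n\, n!} t^n\) converges and equals \(\exp\big(xt - \tfrac{1}{4}t^2\big)\). -/
open Nat

/-- The physicists' Hermite polynomials
`H_n(x) = n! ∑_{k=0}^{⌊n/2⌋} (-1)^k (2x)^(n-2k) / (k! (n-2k)!)`. -/
noncomputable def hermiteH (n : ℕ) (x : ℝ) : ℝ :=
  (n ! : ℝ) * ∑ k ∈ Finset.range (n / 2 + 1),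
    (-1 : ℝ) ^ k * (2 * x) ^ (n - 2 * k) / ((k ! : ℝ) * ((n - 2 * k)! : ℝ))

/-- Generating function of the physicists' Hermite polynomials:
`∑_{n=0}^∞ H_n(x)/(2^n n!) t^n = exp(x t - t²/4)`. -/
theorem hermiteH_generating_function (x t : ℝ) :
    HasSum (fun n : ℕ => hermiteH n x / ((2 : ℝ) ^ n * (n ! : ℝ)) * t ^ n)
      (Real.exp (x * t - t ^ 2 / 4)) := by
  have ha : HasSum (fun j : ℕ => (x * t) ^ j / (j ! : ℝ)) (Real.exp (x * t)) := by
    rw [Real.exp_eq_exp_ℝ]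
    exact NormedSpace.expSeries_div_hasSum_exp (x * t)
  have hb : HasSum (fun k : ℕ => (-(t ^ 2 / 4)) ^ k / (k ! : ℝ)) (Real.exp (-(t ^ 2 / 4))) := by
    rw [Real.exp_eq_exp_ℝ]
    exact NormedSpace.expSeries_div_hasSum_exp (-(t ^ 2 / 4))
  have hab := ha.mul hb (summable_mul_of_summable_norm
    (Real.summable_pow_div_factorial (x * t)).norm
    (Real.summable_pow_div_factorial (-(t ^ 2 / 4))).norm)
  rw [← Real.exp_add, ← sub_eq_add_neg] at hab
  -- Reindex the double series by `(j, k) ↦ (j + 2 * k, k)`, extending it by zero.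
  let f : ℕ × ℕ → ℝ := fun p => if 2 * p.2 ≤ p.1 then
    (x * t) ^ (p.1 - 2 * p.2) / ((p.1 - 2 * p.2)! : ℝ) * ((-(t ^ 2 / 4)) ^ p.2 / (p.2 ! : ℝ)) else 0
  have hinj : Function.Injective (fun p : ℕ × ℕ => (p.1 + 2 * p.2, p.2)) := by
    rintro ⟨a, b⟩ ⟨c, d⟩ h
    simp only [Prod.mk.injEq] at h ⊢
    omega
  have hf : HasSum f (Real.exp (x * t - t ^ 2 / 4)) := by
    refine (hinj.hasSum_iff ?_).1 ?_
    · rintro ⟨n, k⟩ h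
      refine if_neg fun hle => h ⟨(n - 2 * k, k), ?_⟩
      simp only [Prod.mk.injEq, and_true]
      exact Nat.sub_add_cancel hle
    · simpa [f, Function.comp_def] using hab
  refine hf.prod_fiberwise fun n => ?_
  have hterm : hermiteH n x / ((2 : ℝ) ^ n * (n ! : ℝ)) * t ^ n
      = ∑ k ∈ Finset.range (n / 2 + 1), f (n, k) := by
    have hn : (n ! : ℝ) ≠ 0 := by positivity
    rw [hermiteH, mul_comm ((2 : ℝ) ^ n), mul_div_mul_left _ _ hn, Finset.sum_div, Finset.sum_mul]
    refine Finset.sum_congr rfl fun k hk => ?_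
    have hle : 2 * k ≤ n := by
      rw [Finset.mem_range] at hk
      omega
    obtain ⟨j, rfl⟩ := Nat.exists_eq_add_of_le hle
    have h4 : (-(t ^ 2 / 4)) ^ k = (-1) ^ k * t ^ (2 * k) / 2 ^ (2 * k) := by
      rw [pow_mul, pow_mul, ← mul_pow, ← div_pow]
      norm_num [neg_div]
    simp only [f, if_pos hle, Nat.add_sub_cancel_left, h4, mul_pow, pow_add]
    field_simp
  rw [hterm]
  refine hasSum_sum_of_ne_finset_zero fun k hk => if_neg ?_
  rw [Finset.mem_range] at hk
  omega
end

section
/- For every real a > 0, every natural number x, and every real t, the series \(\sum_{n=0}^{\infty} \frac{(-a)^n C_n(x;a)}{n!} t^n\) converges and equals \(e^{-at}(1+t)^x\). -/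
open Nat

/-- The Pochhammer symbol `(a)_k = a (a+1) ⋯ (a+k-1)`. -/
noncomputable def poch (a : ℝ) (k : ℕ) : ℝ :=
  ∏ j ∈ Finset.range k, (a + (j : ℝ))

/-- The Charlier polynomials
`C_n(x;a) = ∑_{k=0}^n (-n)_k (-x)_k / k! · (-1/a)^k`. -/
noncomputable def charlier (n : ℕ) (x : ℕ) (a : ℝ) : ℝ :=
  ∑ k ∈ Finset.range (n + 1),
    poch (-(n : ℝ)) k * poch (-(x : ℝ)) k / (k ! : ℝ) * (-(1 / a)) ^ k

theorem poch_neg_natCast (n k : ℕ) :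
    poch (-(n : ℝ)) k = (-1) ^ k * (n.descFactorial k : ℝ) := by
  induction k with
  | zero => simp [poch]
  | succ k ih =>
    rw [poch, Finset.prod_range_succ, ← poch, ih, Nat.descFactorial_succ, Nat.cast_mul]
    rcases le_or_gt k n with h | h
    · rw [Nat.cast_sub h]
      ring
    · simp [Nat.descFactorial_eq_zero_iff_lt.mpr h]

theorem charlier_coeff_eq_sum {a : ℝ} (ha : a ≠ 0) (n x : ℕ) (t : ℝ) :
    (-a) ^ n * charlier n x a / (n ! : ℝ) * t ^ n =
      ∑ k ∈ Finset.range (n + 1),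
        (t ^ k * (x.choose k : ℝ)) * ((-(a * t)) ^ (n - k) / ((n - k)! : ℝ)) := by
  rw [charlier, Finset.mul_sum, Finset.sum_div, Finset.sum_mul]
  refine Finset.sum_congr rfl fun k hk => ?_
  obtain ⟨m, rfl⟩ := Nat.exists_eq_add_of_le (Nat.lt_succ_iff.mp (Finset.mem_range.mp hk))
  have hfac : ((k + m)! : ℝ) = (m ! : ℝ) * ((k + m).descFactorial k : ℝ) := by
    have h := Nat.factorial_mul_descFactorial (Nat.le_add_right k m)
    rw [Nat.add_sub_cancel_left] at h
    exact_mod_cast h.symm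
  have hdesc : ((k + m).descFactorial k : ℝ) ≠ 0 := by
    intro h
    exact Nat.cast_ne_zero.mpr (Nat.factorial_ne_zero (k + m)) (hfac.trans (by rw [h, mul_zero]))
  have hm : (m ! : ℝ) ≠ 0 := Nat.cast_ne_zero.mpr m.factorial_ne_zero
  have hk' : (k ! : ℝ) ≠ 0 := Nat.cast_ne_zero.mpr k.factorial_ne_zero
  have hsign : ((-1 : ℝ) ^ k) * (-1) ^ k = 1 := by rw [← mul_pow]; norm_num
  have hpow : (-a) ^ k * (-(1 / a)) ^ k = 1 := by
    rw [← mul_pow, neg_mul_neg, mul_one_div_cancel ha, one_pow]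
  rw [poch_neg_natCast, poch_neg_natCast, Nat.descFactorial_eq_factorial_mul_choose x,
    Nat.cast_mul, Nat.add_sub_cancel_left, hfac, ← neg_mul, mul_pow, pow_add, pow_add]
  generalize (-a) ^ k = q, (-(1 / a)) ^ k = p, (-1 : ℝ) ^ k = s at hpow hsign ⊢
  field_simp
  linear_combination ((-a) ^ m * (x.choose k : ℝ) * t ^ m * t ^ k) * (s ^ 2 * hpow + hsign)

/-- Generating function of the Charlier polynomials:
`∑_{n=0}^∞ (-a)^n C_n(x;a)/n! · t^n = e^{-at} (1+t)^x`. -/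
theorem charlier_generating_function (a : ℝ) (ha : 0 < a) (x : ℕ) (t : ℝ) :
    HasSum (fun n : ℕ => (-a) ^ n * charlier n x a / (n ! : ℝ) * t ^ n)
      (Real.exp (-(a * t)) * (1 + t) ^ x) := by
  have hbinom : HasSum (fun k : ℕ => t ^ k * (x.choose k : ℝ)) ((1 + t) ^ x) := by
    have h : HasSum (fun k : ℕ => t ^ k * (x.choose k : ℝ))
        (∑ k ∈ Finset.range (x + 1), t ^ k * (x.choose k : ℝ)) :=
      hasSum_sum_of_ne_finset_zero fun k hk => by
        rw [Finset.mem_range] at hk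
        rw [Nat.choose_eq_zero_of_lt (by omega), Nat.cast_zero, mul_zero]
    simpa [add_comm (1 : ℝ), add_pow] using h
  have hexp : HasSum (fun k : ℕ => (-(a * t)) ^ k / (k ! : ℝ)) (Real.exp (-(a * t))) := by
    rw [Real.exp_eq_exp_ℝ]
    exact NormedSpace.expSeries_div_hasSum_exp _
  have h := hasSum_sum_range_mul_of_summable_norm hbinom.summable.norm hexp.summable.norm
  rw [hbinom.tsum_eq, hexp.tsum_eq, mul_comm (_ ^ x)] at h
  simpa only [charlier_coeff_eq_sum ha.ne'] using h
end

section
/- For every real p with 0 < p < 1, every natural number N, and all natural numbers m ≠ n with m ≤ N and n ≤ N, \(\sum_{x=0}^{N} \binom{N}{x} p^x (1-p)^{N-x}\, K_m(x;p,N)\, K_n(x;p,N) = 0\). -/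
open Nat

/-- The Krawtchouk polynomials
`K_n(x;p,N) = ∑_{k=0}^n (-n)_k (-x)_k / ((-N)_k k!) · p^{-k}`. -/
noncomputable def krawtchouk (n : ℕ) (x : ℕ) (p : ℝ) (N : ℕ) : ℝ :=
  ∑ k ∈ Finset.range (n + 1),
    poch (-(n : ℝ)) k * poch (-(x : ℝ)) k / (poch (-(N : ℝ)) k * (k ! : ℝ)) * (p⁻¹) ^ k

theorem poch_succ (a : ℝ) (k : ℕ) : poch a (k + 1) = poch a k * (a + k) :=
  Finset.prod_range_succ _ _

theorem poch_succ' (a : ℝ) (k : ℕ) : poch a (k + 1) = a * poch (a + 1) k := by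
  simp only [poch, Finset.prod_range_succ', Nat.cast_add, Nat.cast_one, Nat.cast_zero, add_zero]
  rw [mul_comm]
  exact congrArg (a * ·) (Finset.prod_congr rfl fun j _ => by ring)

theorem poch_neg_natCast_ne_zero {N k : ℕ} (hk : k ≤ N) : poch (-(N : ℝ)) k ≠ 0 := by
  refine Finset.prod_ne_zero_iff.mpr fun j hj => ?_
  have hjN : (j : ℝ) < N := by
    exact_mod_cast (Finset.mem_range.mp hj).trans_le hk
  linarith

/-- The coefficient of `(-x)_k` in the Krawtchouk polynomial `K_n(x;p,N)`. -/
noncomputable def krawtchoukCoeff (n : ℕ) (p : ℝ) (N k : ℕ) : ℝ :=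
  poch (-(n : ℝ)) k / (poch (-(N : ℝ)) k * (k ! : ℝ)) * (p⁻¹) ^ k

/-- The Krawtchouk polynomial as a function of a real variable. -/
noncomputable def krawtchoukReal (n : ℕ) (p : ℝ) (N : ℕ) (x : ℝ) : ℝ :=
  ∑ k ∈ Finset.range (n + 1), krawtchoukCoeff n p N k * poch (-x) k

theorem krawtchouk_eq_krawtchoukReal (n x : ℕ) (p : ℝ) (N : ℕ) :
    krawtchouk n x p N = krawtchoukReal n p N x :=
  Finset.sum_congr rfl fun k _ => by
    rw [krawtchoukCoeff]
    ring

theorem krawtchoukCoeff_succ {p : ℝ} (hp : p ≠ 0) (n : ℕ) {N k : ℕ} (hk : k < N) :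
    (k + 1) * p * (N - k) * krawtchoukCoeff n p N (k + 1) =
      (n - k) * krawtchoukCoeff n p N k := by
  have hN : poch (-(N : ℝ)) k ≠ 0 := poch_neg_natCast_ne_zero hk.le
  have hNk : -(N : ℝ) + k ≠ 0 := by
    have : (k : ℝ) < N := by exact_mod_cast hk
    linarith
  have hk1 : (k : ℝ) + 1 ≠ 0 := by positivity
  have hf : (k ! : ℝ) ≠ 0 := by positivity
  simp only [krawtchoukCoeff, poch_succ, Nat.factorial_succ, pow_succ]
  push_cast
  field_simp
  ring

/-- The operator `f ↦ p(N-x)(f(x+1)-f(x)) + x(1-p)(f(x-1)-f(x))`, of which the Krawtchouk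
polynomials are eigenfunctions. -/
def krawtchoukOp (p : ℝ) (N : ℕ) (f : ℝ → ℝ) (x : ℝ) : ℝ :=
  p * (N - x) * (f (x + 1) - f x) + x * (1 - p) * (f (x - 1) - f x)

theorem krawtchoukOp_poch_succ (p : ℝ) (N k : ℕ) (x : ℝ) :
    krawtchoukOp p N (fun y => poch (-y) (k + 1)) x =
      -((k + 1) * p * (N - k) * poch (-x) k) - (k + 1) * poch (-x) (k + 1) := by
  have h1 : poch (-(x + 1)) (k + 1) = (-x - 1) * poch (-x) k := by
    rw [poch_succ', show -(x + 1) + 1 = -x by ring]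
    ring
  have h2 : x * poch (-(x - 1)) (k + 1) = -(poch (-x) k * (-x + k) * (-x + k + 1)) := by
    have h := poch_succ' (-x) (k + 1)
    rw [poch_succ, poch_succ, show -x + 1 = -(x - 1) by ring] at h
    push_cast at h
    linear_combination h
  have h3 := poch_succ (-x) k
  simp only [krawtchoukOp]
  rw [h1, h3]
  linear_combination (1 - p) * h2

theorem sum_krawtchoukCoeff_mul_krawtchoukOp_poch {p : ℝ} (hp : p ≠ 0) (n : ℕ) {N M : ℕ}
    (hM : M ≤ N) (x : ℝ) :
    ∑ k ∈ Finset.range (M + 1), krawtchoukCoeff n p N k *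
        (krawtchoukOp p N (fun y => poch (-y) k) x + n * poch (-x) k) =
      (n - M) * krawtchoukCoeff n p N M * poch (-x) M := by
  induction M with
  | zero =>
    simp [krawtchoukOp, poch]
    ring
  | succ M ih =>
    rw [Finset.sum_range_succ, ih (by omega), krawtchoukOp_poch_succ]
    push_cast
    linear_combination -poch (-x) M * krawtchoukCoeff_succ hp n (show M < N by omega)

theorem krawtchoukOp_krawtchoukReal {p : ℝ} (hp : p ≠ 0) {n N : ℕ} (hn : n ≤ N) (x : ℝ) :
    krawtchoukOp p N (krawtchoukReal n p N) x = -n * krawtchoukReal n p N x := by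
  have h := sum_krawtchoukCoeff_mul_krawtchoukOp_poch hp n hn x
  rw [sub_self, zero_mul, zero_mul] at h
  rw [neg_mul, eq_neg_iff_add_eq_zero, ← h]
  simp only [krawtchoukOp, krawtchoukReal, ← Finset.sum_sub_distrib, Finset.mul_sum,
    ← Finset.sum_add_distrib]
  exact Finset.sum_congr rfl fun k _ => by ring

/-- Detailed balance for the binomial weight. -/
theorem binomial_weight_succ (p : ℝ) {N x : ℕ} (hx : x < N) :
    (N.choose (x + 1) : ℝ) * p ^ (x + 1) * (1 - p) ^ (N - (x + 1)) * ((x + 1) * (1 - p)) =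
      (N.choose x : ℝ) * p ^ x * (1 - p) ^ (N - x) * (p * (N - x)) := by
  have h : (N.choose (x + 1) : ℝ) * (x + 1) = N.choose x * (N - x) := by
    rw [← Nat.cast_sub hx.le]
    exact_mod_cast Nat.choose_succ_right_eq N x
  rw [show N - x = N - (x + 1) + 1 by omega, pow_succ, pow_succ]
  linear_combination p ^ x * p * (1 - p) ^ (N - (x + 1)) * (1 - p) * h

/-- Summation by parts: the operator `krawtchoukOp` is symmetric with respect to the binomial
weight, up to a boundary term. -/
theorem sum_binomial_weight_mul_krawtchoukOp_sub (p : ℝ) (f g : ℝ → ℝ) {N M : ℕ} (hM : M ≤ N) :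
    ∑ x ∈ Finset.range (M + 1), (N.choose x : ℝ) * p ^ x * (1 - p) ^ (N - x) *
        (f x * krawtchoukOp p N g x - g x * krawtchoukOp p N f x) =
      (N.choose M : ℝ) * p ^ M * (1 - p) ^ (N - M) * (p * (N - M)) *
        (f M * g (M + 1) - f (M + 1) * g M) := by
  induction M with
  | zero =>
    simp [krawtchoukOp]
    ring
  | succ M ih =>
    rw [Finset.sum_range_succ, ih (by omega)]
    simp only [krawtchoukOp]
    push_cast
    rw [add_sub_cancel_right]
    linear_combination (-(f M * g (M + 1) - f (M + 1) * g M)) *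
      binomial_weight_succ p (show M < N by omega)

/-- Orthogonality of the Krawtchouk polynomials: for `m ≠ n` with `m, n ≤ N`,
`∑_{x=0}^N (N choose x) p^x (1-p)^(N-x) K_m(x;p,N) K_n(x;p,N) = 0`. -/
theorem krawtchouk_orthogonality (p : ℝ) (hp0 : 0 < p) (hp1 : p < 1) (N : ℕ)
    (m n : ℕ) (hm : m ≤ N) (hn : n ≤ N) (hmn : m ≠ n) :
    ∑ x ∈ Finset.range (N + 1),
      (N.choose x : ℝ) * p ^ x * (1 - p) ^ (N - x) * krawtchouk m x p N * krawtchouk n x p N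
      = 0 := by
  have hp : p ≠ 0 := hp0.ne'
  have h := sum_binomial_weight_mul_krawtchoukOp_sub p (krawtchoukReal m p N)
    (krawtchoukReal n p N) (le_refl N)
  simp only [krawtchoukOp_krawtchoukReal hp hm, krawtchoukOp_krawtchoukReal hp hn, sub_self,
    mul_zero, zero_mul] at h
  have hne : (m : ℝ) - n ≠ 0 := sub_ne_zero.mpr (by exact_mod_cast hmn)
  refine (_root_.mul_eq_zero.mp ?_).resolve_left hne
  rw [← h, Finset.mul_sum]
  refine Finset.sum_congr rfl fun x _ => ?_
  rw [krawtchouk_eq_krawtchoukReal, krawtchouk_eq_krawtchoukReal]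
  ring
end

section
/- Let \((a_k)_{k \ge 2}\) be real numbers and let T be the linear operator on real polynomials given by \(Tp = p' + \sum_{k \ge 2} a_k\, p^{(k)}\) (a finite sum for each polynomial p). Let \(\Lambda\) be a nonzero linear map from real polynomials to real polynomials satisfying \((\Lambda p)' = \Lambda(Tp)\) for all polynomials p. Then there exists a natural number \(\mu\) such that \(\Lambda p = 0\) for every polynomial p with \(\deg p < \mu\), and \(\deg(\Lambda p) = \deg p - \mu\) for every nonzero polynomial p with \(\deg p \ge \mu\). -/
open Polynomial

/-- The top coefficients of `p' + ∑_{k ≥ 2} a_k p^{(k)}` are those of `p'`. -/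
theorem coeff_derivative_add_sum_iterate_derivative (a : ℕ → ℝ) (p : ℝ[X]) {m : ℕ}
    (hm : p.natDegree ≤ m + 1) :
    (derivative p + ∑ k ∈ Finset.Icc 2 p.natDegree,
      a k • (⇑(derivative (R := ℝ)))^[k] p).coeff m = p.coeff (m + 1) * (m + 1) := by
  rw [coeff_add, coeff_derivative, finsetSum_coeff, Finset.sum_eq_zero, add_zero]
  intro k hk
  rw [coeff_smul, coeff_iterate_derivative, coeff_eq_zero_of_natDegree_lt, smul_zero, smul_zero]
  have := (Finset.mem_Icc.mp hk).1
  omega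

/-- If `Λ ≠ 0` is a linear operator on real polynomials intertwining differentiation with
`T = D + ∑_{k≥2} a_k D^k` (i.e. `(Λp)' = Λ(Tp)`), then there is a `μ ∈ ℕ` such that `Λ`
kills polynomials of degree `< μ` and lowers the degree of other polynomials by exactly `μ`. -/
theorem lambda_lowers_degree (a : ℕ → ℝ)
    (T : Polynomial ℝ →ₗ[ℝ] Polynomial ℝ)
    (hT : ∀ p : Polynomial ℝ,
      T p = derivative p +
        ∑ k ∈ Finset.Icc 2 p.natDegree, a k • (⇑(derivative (R := ℝ)))^[k] p)
    (Λ : Polynomial ℝ →ₗ[ℝ] Polynomial ℝ) (hΛ : Λ ≠ 0)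
    (hcomm : ∀ p : Polynomial ℝ, derivative (Λ p) = Λ (T p)) :
    ∃ μ : ℕ,
      (∀ p : Polynomial ℝ, p.degree < (μ : WithBot ℕ) → Λ p = 0) ∧
      (∀ p : Polynomial ℝ, p ≠ 0 → μ ≤ p.natDegree →
        (Λ p).degree = ((p.natDegree - μ : ℕ) : WithBot ℕ)) := by
  classical
  have hTcoeff : ∀ (p : ℝ[X]) (m : ℕ), p.natDegree ≤ m + 1 →
      (T p).coeff m = p.coeff (m + 1) * (m + 1) := fun p m hm => by
    rw [hT, coeff_derivative_add_sum_iterate_derivative a p hm]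
  have hTdeg : ∀ (p : ℝ[X]) (m : ℕ), p.natDegree ≤ m → (T p).degree < m := by
    intro p m hm
    refine (degree_lt_iff_coeff_zero _ _).mpr fun k hk => ?_
    rw [hTcoeff p k (by omega), coeff_eq_zero_of_natDegree_lt (by omega), zero_mul]
  have hex : ∃ n : ℕ, ∃ p : ℝ[X], p.natDegree = n ∧ Λ p ≠ 0 := by
    by_contra! h
    exact hΛ (LinearMap.ext fun p => h _ p rfl)
  obtain ⟨p₀, hp₀, hΛp₀⟩ := Nat.find_spec hex
  have hmin : ∀ p : ℝ[X], p.natDegree < Nat.find hex → Λ p = 0 := by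
    intro p hp
    by_contra h
    exact Nat.find_min hex hp ⟨p, rfl, h⟩
  generalize Nat.find hex = μ at hp₀ hmin
  have hlow : ∀ p : ℝ[X], p.degree < (μ : WithBot ℕ) → Λ p = 0 := by
    intro p hp
    rcases eq_or_ne p 0 with rfl | h0
    · exact map_zero Λ
    · exact hmin p ((natDegree_lt_iff_degree_lt h0).mpr hp)
  have hp₀_ne : p₀ ≠ 0 := by
    rintro rfl
    exact hΛp₀ (map_zero Λ)
  have key : ∀ (d : ℕ) (p : ℝ[X]), p ≠ 0 → p.natDegree = μ + d → (Λ p).degree = d := by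
    intro d
    induction d with
    | zero =>
      intro p hp hd
      have hne : Λ p ≠ 0 := by
        intro h
        have hlt : (C p.leadingCoeff * p₀ - C p₀.leadingCoeff * p).degree < (μ : WithBot ℕ) := by
          refine (degree_lt_iff_coeff_zero _ _).mpr fun k hk => ?_
          rw [coeff_sub, coeff_C_mul, coeff_C_mul]
          rcases hk.eq_or_lt with rfl | hk
          · rw [leadingCoeff, leadingCoeff, hp₀, hd, add_zero]
            ring
          · rw [coeff_eq_zero_of_natDegree_lt (p := p) (by omega),
              coeff_eq_zero_of_natDegree_lt (p := p₀) (by omega)]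
            ring
        have h2 := hlow _ hlt
        rw [← smul_eq_C_mul, ← smul_eq_C_mul, map_sub, map_smul, map_smul, h, smul_zero,
          sub_zero, smul_eq_zero] at h2
        exact h2.elim (leadingCoeff_ne_zero.mpr hp) hΛp₀
      have hder : derivative (Λ p) = 0 := by
        rw [hcomm]
        exact hlow _ (hTdeg p μ (by omega))
      rw [degree_eq_natDegree hne, derivative_eq_zero.mp hder]
    | succ d ih =>
      intro p hp hd
      have hc : (T p).coeff (μ + d) ≠ 0 := by
        rw [hTcoeff p _ (by omega)]
        refine mul_ne_zero ?_ (by positivity)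
        have := leadingCoeff_ne_zero.mpr hp
        rwa [leadingCoeff, hd] at this
      have hTne : T p ≠ 0 := by
        intro h
        simp [h] at hc
      have hTnat : (T p).natDegree = μ + d := by
        refine le_antisymm ?_ (le_natDegree_of_ne_zero hc)
        have := (natDegree_lt_iff_degree_lt hTne).mpr (hTdeg p (μ + d + 1) (by omega))
        omega
      have hder := ih _ hTne hTnat
      rw [← hcomm] at hder
      have hpos : 0 < (Λ p).natDegree := by
        by_contra! h
        rw [derivative_of_natDegree_zero (by omega), degree_zero] at hder
        exact WithBot.bot_ne_natCast d hder
      rw [degree_derivative hpos.ne'] at hder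
      have : (Λ p).natDegree - 1 = d := by exact_mod_cast hder
      rw [degree_eq_iff_natDegree_eq_of_pos (by omega)]
      omega
  exact ⟨μ, hlow, fun p hp hle => key _ p hp (by omega)⟩
end

section
/- Let \((a_k)_{k \ge 2}\) be real numbers and let T be the linear operator on real polynomials given by \(Tp = p' + \sum_{k \ge 2} a_k\, p^{(k)}\) (a finite sum for each polynomial p). Let \((P_n)_{n \ge 0}\) be monic real polynomials with \(\deg P_n = n\), \(P_0 = 1\), and \(T P_n = n\, P_{n-1}\) for all n ≥ 1. Suppose there are real sequences \((l_n)_{n \ge 1}\) and \((k_n)_{n \ge 2}\) such that \(P_1(x) = x + l_1\) and \(P_{n+1}(x) = (x + l_{n+1}) P_n(x) + k_{n+1} P_{n-1}(x)\) for all n ≥ 1. Then, setting \(\lambda = l_2 - l_1\) and \(\kappa = \tfrac{k_3}{2} - k_2\), one has \(l_{n+1} = l_1 + n\lambda\) and \(k_{n+1} = n\,(k_2 + (n-1)\kappa)\) for all n ≥ 1. -/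
open Polynomial

section LoweringOperator

variable {a : ℕ → ℝ} {T : ℝ[X] →ₗ[ℝ] ℝ[X]}

theorem lowering_apply_of_natDegree_le
    (hT : ∀ p : ℝ[X], T p = derivative p +
      ∑ k ∈ Finset.Icc 2 p.natDegree, a k • (⇑(derivative (R := ℝ)))^[k] p)
    (p : ℝ[X]) {N : ℕ} (hN : p.natDegree ≤ N) :
    T p = derivative p + ∑ k ∈ Finset.Icc 2 N, a k • (⇑(derivative (R := ℝ)))^[k] p := by
  rw [hT p]
  congr 1
  refine Finset.sum_subset (Finset.Icc_subset_Icc_right hN) fun k hk hk' => ?_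
  rw [iterate_derivative_eq_zero, smul_zero]
  simp only [Finset.mem_Icc] at hk hk'
  omega

theorem lowering_commute_of_commute_derivative
    (hT : ∀ p : ℝ[X], T p = derivative p +
      ∑ k ∈ Finset.Icc 2 p.natDegree, a k • (⇑(derivative (R := ℝ)))^[k] p)
    (S : ℝ[X] →ₗ[ℝ] ℝ[X]) (hS : ∀ p, S (derivative p) = derivative (S p)) (p : ℝ[X]) :
    S (T p) = T (S p) := by
  have hiter : ∀ k p, S ((⇑(derivative (R := ℝ)))^[k] p) = (⇑(derivative (R := ℝ)))^[k] (S p) :=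
    fun k p => (Function.Semiconj.iterate_right (f := S) hS k) p
  rw [lowering_apply_of_natDegree_le hT p (le_max_left _ (S p).natDegree),
    lowering_apply_of_natDegree_le hT (S p) (le_max_right p.natDegree _)]
  simp only [map_add, map_sum, map_smul, hS, hiter]

theorem lowering_commute_pincherle
    (hT : ∀ p : ℝ[X], T p = derivative p +
      ∑ k ∈ Finset.Icc 2 p.natDegree, a k • (⇑(derivative (R := ℝ)))^[k] p) (p : ℝ[X]) :
    T (T (X * p) - X * T p) = T (X * T p) - X * T (T p) := by
  have hD : ∀ q, derivative (T q) = T (derivative q) :=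
    lowering_commute_of_commute_derivative hT derivative fun _ => rfl
  let S : ℝ[X] →ₗ[ℝ] ℝ[X] := T ∘ₗ LinearMap.mulLeft ℝ X - LinearMap.mulLeft ℝ X ∘ₗ T
  refine (lowering_commute_of_commute_derivative hT S (fun q => ?_) p).symm
  simp only [S, LinearMap.sub_apply, LinearMap.comp_apply, LinearMap.mulLeft_apply, map_sub, hD,
    derivative_mul, derivative_X, one_mul, map_add]
  ring

end LoweringOperator

theorem coeffs_eq_zero_of_monic_succ {P : ℕ → ℝ[X]} (hmonic : ∀ n, (P n).Monic)
    (hdeg : ∀ n, (P n).natDegree = n) {n : ℕ} {c d : ℝ}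
    (h : C c * P (n + 1) + C d * P n = 0) : c = 0 ∧ d = 0 := by
  have hlead : ∀ m, (P m).coeff m = 1 := fun m => by
    simpa [Monic, leadingCoeff, hdeg m] using hmonic m
  have hc : c = 0 := by
    have := congrArg (coeff · (n + 1)) h
    simpa [hlead, coeff_eq_zero_of_natDegree_lt (show (P n).natDegree < n + 1 by simp [hdeg])]
      using this
  subst hc
  have := congrArg (coeff · n) h
  exact ⟨rfl, by simpa [hlead] using this⟩

theorem eq_add_mul_of_second_difference_eq_zero {u : ℕ → ℝ}
    (h : ∀ n, u (n + 2) - u (n + 1) = u (n + 1) - u n) (n : ℕ) :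
    u n = u 0 + n * (u 1 - u 0) := by
  have hd : ∀ n, u (n + 1) - u n = u 1 - u 0 := fun n => by
    induction n with
    | zero => rfl
    | succ n ih => rw [h, ih]
  induction n with
  | zero => simp
  | succ n ih =>
    push_cast
    linarith [hd n]

/-- For monic polynomials `P_n` of degree `n` with `P_0 = 1`, satisfying the lowering
property `T P_n = n P_{n-1}` for `T = D + ∑_{k≥2} a_k D^k` and a three-term recurrence
`P_{n+1}(x) = (x + l_{n+1}) P_n(x) + k_{n+1} P_{n-1}(x)`, the recurrence coefficients
are forced to be `l_{n+1} = l_1 + nλ` and `k_{n+1} = n (k_2 + (n-1)κ)`, where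
`λ = l_2 - l_1` and `κ = k_3/2 - k_2`. -/
theorem meixner_recurrence_coefficients (a : ℕ → ℝ)
    (T : Polynomial ℝ →ₗ[ℝ] Polynomial ℝ)
    (hT : ∀ p : Polynomial ℝ,
      T p = Polynomial.derivative p +
        ∑ k ∈ Finset.Icc 2 p.natDegree, a k • (⇑(Polynomial.derivative (R := ℝ)))^[k] p)
    (P : ℕ → Polynomial ℝ) (hmonic : ∀ n, (P n).Monic) (hdeg : ∀ n, (P n).natDegree = n)
    (hP0 : P 0 = 1)
    (hlow : ∀ n : ℕ, 1 ≤ n → T (P n) = (n : ℝ) • P (n - 1))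
    (l : ℕ → ℝ) (k : ℕ → ℝ)
    (hP1 : P 1 = X + C (l 1))
    (hrec : ∀ n : ℕ, 1 ≤ n →
      P (n + 1) = (X + C (l (n + 1))) * P n + C (k (n + 1)) * P (n - 1)) :
    ∀ n : ℕ, 1 ≤ n →
      l (n + 1) = l 1 + n * (l 2 - l 1) ∧
      k (n + 1) = n * (k 2 + (n - 1 : ℝ) * (k 3 / 2 - k 2)) := by
  have hTC : ∀ (c : ℝ) p, T (C c * p) = C c * T p := fun c p => by
    rw [← smul_eq_C_mul, map_smul, smul_eq_C_mul]
  have hlow' : ∀ n : ℕ, T (P (n + 1)) = C (n + 1 : ℝ) * P n := fun n => by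
    rw [hlow (n + 1) (by omega), smul_eq_C_mul]
    simp
  have hT1 : T (P 0) = 0 := by rw [hT, hP0]; simp
  set S : ℝ[X] → ℝ[X] := fun p => T (X * p) - X * T p with hSdef
  have hSC : ∀ (c : ℝ) p, S (C c * p) = C c * S p := fun c p => by
    simp only [hSdef, hTC, mul_left_comm X (C c)]
    ring
  have hST : ∀ p, T (S p) = S (T p) := lowering_commute_pincherle hT
  have hfirst : P 1 = S (P 1) + C (l 2 - l 1) * P 0 := by
    have h := congrArg T (hrec 1 le_rfl)
    have h1 := hlow' 1
    have h0 := hlow' 0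
    simp only [Nat.sub_self, Nat.reduceAdd, add_mul, map_add, hTC, hT1] at h h1 h0
    simp only [hSdef, h0]
    rw [h1, h0] at h
    rw [hP0] at h ⊢
    simp only [map_sub, map_one, Nat.cast_one, Nat.cast_zero, map_zero] at h ⊢
    linear_combination h - hP1
  have hpinch : ∀ n : ℕ, P (n + 2) = S (P (n + 2)) +
      C ((n + 2) * (l (n + 3) - l (n + 2))) * P (n + 1) +
      C ((n + 1) * k (n + 3) - (n + 2) * k (n + 2)) * P n := fun n => by
    have h := congrArg T (hrec (n + 2) (by omega))
    have hr := hrec (n + 1) (by omega)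
    have h3 := hlow' (n + 2)
    have h2 := hlow' (n + 1)
    have h1 := hlow' n
    simp only [show n + 2 + 1 = n + 3 from rfl, show n + 1 + 1 = n + 2 from rfl,
      show n + 2 - 1 = n + 1 from rfl, show n + 1 - 1 = n from rfl,
      add_mul, map_add, hTC] at h hr h1 h2 h3
    simp only [hSdef]
    rw [h3, h2, h1] at h
    rw [h2]
    have hC2 : (C (2 : ℝ) : ℝ[X]) = 2 := rfl
    simp only [map_add, map_sub, map_mul, map_one, Nat.cast_add, Nat.cast_one, Nat.cast_ofNat,
      hC2] at h ⊢
    linear_combination h - (C (n : ℝ) + 2) * hr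
  have hl2 : l 3 - l 2 = l 2 - l 1 := by
    have h := congrArg T (hpinch 0)
    have h2 := hlow' 1
    have h1 := hlow' 0
    simp only [Nat.reduceAdd, zero_add, map_add T, hTC, hST] at h h2 h1
    rw [h2, h1, hSC, hT1, hP0] at h
    rw [hP0] at hfirst
    have : C (2 * (l 3 - l 2) - 2 * (l 2 - l 1)) = (0 : ℝ[X]) := by
      have hC2 : (C (2 : ℝ) : ℝ[X]) = 2 := rfl
      simp only [map_add, map_sub, map_mul, map_one, Nat.cast_one, Nat.cast_zero, map_zero,
        hC2] at h hfirst ⊢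
      linear_combination 2 * hfirst - h
    linarith [C_eq_zero.mp this]
  have hdiff : ∀ n : ℕ,
      (n + 3 : ℝ) * (n + 2) * ((l (n + 4) - l (n + 3)) - (l (n + 3) - l (n + 2))) = 0 ∧
      (n + 1 : ℝ) * ((n + 2) * k (n + 4) - (n + 3) * k (n + 3)) -
        (n + 3) * ((n + 1) * k (n + 3) - (n + 2) * k (n + 2)) = 0 := fun n => by
    refine coeffs_eq_zero_of_monic_succ hmonic hdeg (n := n) ?_
    have h := congrArg T (hpinch (n + 1))
    have hp := hpinch n
    have h3 := hlow' (n + 2)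
    have h2 := hlow' (n + 1)
    have h1 := hlow' n
    simp only [show n + 2 + 1 = n + 3 from rfl, show n + 1 + 1 = n + 2 from rfl,
      show n + 1 + 3 = n + 4 from rfl,
      map_add T, hTC, hST] at h h1 h2 h3
    rw [h3, h2, h1, hSC] at h
    have hC2 : (C (2 : ℝ) : ℝ[X]) = 2 := rfl
    have hC3 : (C (3 : ℝ) : ℝ[X]) = 3 := rfl
    simp only [map_add, map_sub, map_mul, map_one, Nat.cast_add, Nat.cast_one, Nat.cast_ofNat,
      hC2, hC3] at h hp ⊢
    linear_combination (C (n : ℝ) + 3) * hp - h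
  have hl : ∀ n : ℕ, l (n + 1) = l 1 + n * (l 2 - l 1) := by
    refine eq_add_mul_of_second_difference_eq_zero (u := fun n => l (n + 1)) fun n => ?_
    cases n with
    | zero => exact hl2
    | succ n =>
      have h := (hdiff n).1
      have hn : (n + 3 : ℝ) * (n + 2) ≠ 0 := by positivity
      exact sub_eq_zero.mp ((mul_eq_zero.mp h).resolve_left hn)
  have hk : ∀ n : ℕ, k (n + 2) / (n + 1) = k 2 + n * (k 3 / 2 - k 2) := fun n => by
    have := eq_add_mul_of_second_difference_eq_zero
      (u := fun n => k (n + 2) / (n + 1)) (fun n => ?_) n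
    · norm_num at this
      exact this
    · have h := (hdiff n).2
      have h1 : (n + 1 : ℝ) ≠ 0 := by positivity
      have h2 : (n + 2 : ℝ) ≠ 0 := by positivity
      have h3 : (n + 3 : ℝ) ≠ 0 := by positivity
      simp only [show n + 2 + 2 = n + 4 from rfl, show n + 1 + 2 = n + 3 from rfl]
      push_cast
      rw [show (n + 2 + 1 : ℝ) = n + 3 by ring, show (n + 1 + 1 : ℝ) = n + 2 by ring]
      field_simp
      linear_combination h
  intro n hn
  refine ⟨hl n, ?_⟩
  obtain ⟨m, rfl⟩ := Nat.exists_eq_add_of_le' hn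
  have hm : (m + 1 : ℝ) ≠ 0 := by positivity
  have h := (div_eq_iff hm).mp (hk m)
  push_cast
  rw [show m + 1 + 1 = m + 2 from rfl, h]
  ring
end

section
/- Let \((P_n)_{n \ge 0}\) be monic real polynomials with \(P_0 = 1\), and suppose there are real sequences \((l_n)_{n \ge 1}\) and \((k_n)_{n \ge 2}\) with \(k_{n+1} < 0\) for all n ≥ 1, such that \(P_1(x) = x + l_1\) and \(P_{n+1}(x) = (x + l_{n+1}) P_n(x) + k_{n+1} P_{n-1}(x)\) for all n ≥ 1. Then there exists a nonzero finite Borel measure \(\mu\) on ℝ whose support is an infinite set, such that every polynomial is \(\mu\)-integrable and \(\int_{\mathbb{R}} P_m(x)\, P_n(x)\, d\mu(x) = 0\) for all m ≠ n. -/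
open Polynomial MeasureTheory

open Filter Topology
open scoped CompactlySupported

/-- A real polynomial that is nonnegative on the real line is a sum of squares. -/
theorem Polynomial.isSumSq_of_eval_nonneg (p : ℝ[X]) (hp : ∀ x, 0 ≤ p.eval x) : IsSumSq p := by
  induction hn : p.natDegree using Nat.strong_induction_on generalizing p with
  | h n ih =>
    subst hn
    by_cases hd : p.natDegree = 0
    · obtain ⟨a, rfl⟩ := natDegree_eq_zero.mp hd
      have ha : 0 ≤ a := by simpa using hp 0
      rw [← Real.mul_self_sqrt ha, C_mul]
      exact IsSumSq.mul_self _
    have hp0 : p ≠ 0 := fun h => hd (by simp [h])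
    -- it suffices to split off a nonconstant sum of squares
    have of_dvd : ∀ q : ℝ[X], IsSumSq q → q.natDegree ≠ 0 → (∀ x, 0 ≤ q.eval x) →
        q ∣ p → IsSumSq p := by
      rintro q hq hqd hq0 ⟨r, rfl⟩
      have hq' : q ≠ 0 := left_ne_zero_of_mul hp0
      have hr' : r ≠ 0 := right_ne_zero_of_mul hp0
      refine hq.mul (ih r.natDegree ?_ r ?_ rfl)
      · rw [natDegree_mul hq' hr']; omega
      · have hdense : Dense ((q.roots.toFinset : Set ℝ)ᶜ) :=
          Set.Countable.dense_compl ℝ (Finset.countable_toSet _)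
        have hcl : IsClosed {x : ℝ | 0 ≤ r.eval x} :=
          isClosed_le continuous_const r.continuous
        have hsub : ((q.roots.toFinset : Set ℝ)ᶜ) ⊆ {x : ℝ | 0 ≤ r.eval x} := by
          intro x hx
          have hx0 : q.eval x ≠ 0 := by simpa [hq'] using hx
          have hpos : 0 < q.eval x := lt_of_le_of_ne (hq0 x) hx0.symm
          have := hp x
          rw [eval_mul] at this
          exact nonneg_of_mul_nonneg_right this hpos
        intro x
        exact closure_minimal hsub hcl (hdense x)
    obtain ⟨z, hz⟩ := Complex.exists_root (f := p.map (algebraMap ℝ ℂ)) (by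
      rw [degree_map]; exact natDegree_pos_iff_degree_pos.mp (Nat.pos_of_ne_zero hd))
    have hz' : aeval z p = 0 := by
      rwa [IsRoot.def, eval_map_algebraMap] at hz
    by_cases him : z.im = 0
    · have hroot : p.eval z.re = 0 := by
        have hzre : z = (algebraMap ℝ ℂ) z.re := Complex.ext (by simp) (by simp [him])
        rw [hzre, aeval_algebraMap_apply] at hz'
        simpa using hz'
      obtain ⟨q, hq⟩ := dvd_iff_isRoot.mpr (show p.IsRoot z.re from hroot)
      have hqroot : q.eval z.re = 0 := by
        have h1 : IsLocalMin (fun x => p.eval x) z.re :=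
          Eventually.of_forall fun x => by simpa [hroot] using hp x
        have h2 := h1.hasDerivAt_eq_zero (p.hasDerivAt z.re)
        rw [hq] at h2
        simpa using h2
      obtain ⟨r, rfl⟩ := dvd_iff_isRoot.mpr (show q.IsRoot z.re from hqroot)
      refine of_dvd ((X - C z.re) * (X - C z.re)) (IsSumSq.mul_self _) ?_
        (fun x => by simpa using mul_self_nonneg _) ⟨r, by rw [hq]; ring⟩
      rw [natDegree_mul (X_sub_C_ne_zero _) (X_sub_C_ne_zero _)]
      simp
    · have hquad : X ^ 2 - C (2 * z.re) * X + C (‖z‖ ^ 2) =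
          (X - C z.re) * (X - C z.re) + C z.im * C z.im := by
        rw [Complex.sq_norm, Complex.normSq_apply]
        simp only [C_add, C_mul, C_ofNat]
        ring
      have hdvd := p.quadratic_dvd_of_aeval_eq_zero_im_ne_zero hz' him
      have hdeg : (X ^ 2 - C (2 * z.re) * X + C (‖z‖ ^ 2)).natDegree = 2 := by compute_degree!
      rw [hquad] at hdvd hdeg
      refine of_dvd _ ((IsSumSq.mul_self _).add (IsSumSq.mul_self _)) (by omega) (fun x => ?_) hdvd
      simpa using add_nonneg (mul_self_nonneg _) (mul_self_nonneg _)

/-- The continuous functions on `ℝ` dominated in absolute value by a polynomial. -/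
def polynomiallyBounded : Submodule ℝ C(ℝ, ℝ) where
  carrier := {f | ∃ p : ℝ[X], ∀ x, |f x| ≤ p.eval x}
  zero_mem' := ⟨0, by simp⟩
  add_mem' := by
    rintro f g ⟨p, hp⟩ ⟨q, hq⟩
    exact ⟨p + q, fun x => by
      simpa using (abs_add_le _ _).trans (add_le_add (hp x) (hq x))⟩
  smul_mem' := by
    rintro c f ⟨p, hp⟩
    exact ⟨C |c| * p, fun x => by
      simpa [abs_mul] using mul_le_mul_of_nonneg_left (hp x) (abs_nonneg c)⟩

theorem Polynomial.abs_eval_le (p : ℝ[X]) (x : ℝ) : |p.eval x| ≤ (1 + p * p).eval x := by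
  simp only [eval_add, eval_one, eval_mul]
  rw [abs_le]
  constructor <;> nlinarith [sq_nonneg (p.eval x + 1), sq_nonneg (p.eval x - 1)]

/-- The inclusion of the polynomials into the polynomially bounded continuous functions. -/
noncomputable def Polynomial.toPolynomiallyBounded : ℝ[X] →ₗ[ℝ] polynomiallyBounded :=
  (toContinuousMapAlgHom (R := ℝ)).toLinearMap.codRestrict polynomiallyBounded
    fun p => ⟨1 + p * p, fun x => by simpa using p.abs_eval_le x⟩

@[simp]
theorem Polynomial.toPolynomiallyBounded_apply (p : ℝ[X]) (x : ℝ) :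
    (p.toPolynomiallyBounded : C(ℝ, ℝ)) x = p.eval x := rfl

theorem Polynomial.toPolynomiallyBounded_injective :
    Function.Injective toPolynomiallyBounded := fun p q h =>
  Polynomial.funext fun x => by
    rw [← toPolynomiallyBounded_apply, h, toPolynomiallyBounded_apply]

/-- A positive functional on polynomials extends to a positive functional on polynomially bounded
continuous functions. -/
theorem exists_positive_extension (L : ℝ[X] →ₗ[ℝ] ℝ)
    (hL : ∀ p : ℝ[X], (∀ x, 0 ≤ p.eval x) → 0 ≤ L p) :
    ∃ G : polynomiallyBounded →ₗ[ℝ] ℝ, (∀ p : ℝ[X], G p.toPolynomiallyBounded = L p) ∧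
      ∀ f : polynomiallyBounded, (∀ x, 0 ≤ (f : C(ℝ, ℝ)) x) → 0 ≤ G f := by
  let e := LinearEquiv.ofInjective toPolynomiallyBounded toPolynomiallyBounded_injective
  let s : PointedCone ℝ polynomiallyBounded :=
    { carrier := {f | ∀ x, 0 ≤ (f : C(ℝ, ℝ)) x}
      zero_mem' := fun x => by simp
      add_mem' := fun hf hg x => by simpa using add_nonneg (hf x) (hg x)
      smul_mem' := fun c f hf x => mul_nonneg c.2 (hf x) }
  obtain ⟨G, hG, hpos⟩ := riesz_extension s ⟨_, L ∘ₗ e.symm.toLinearMap⟩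
    (by
      rintro ⟨_, p, rfl⟩ hp
      have he : e.symm ⟨toPolynomiallyBounded p, p, rfl⟩ = p := e.symm_apply_apply p
      change 0 ≤ L (e.symm _)
      rw [he]
      exact hL p hp)
    (by
      rintro ⟨f, p, hp⟩
      refine ⟨e p, fun x => ?_⟩
      have := neg_le_of_abs_le (hp x)
      change 0 ≤ p.eval x + f x
      linarith)
  refine ⟨G, fun p => ?_, hpos⟩
  refine (hG (e p)).trans ?_
  change L (e.symm (e p)) = _
  rw [e.symm_apply_apply]

theorem CompactlySupportedContinuousMap.toContinuousMap_mem_polynomiallyBounded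
    (f : C_c(ℝ, ℝ)) : f.toContinuousMap ∈ polynomiallyBounded := by
  obtain ⟨M, hM⟩ := f.hasCompactSupport.exists_bound_of_continuous f.continuous
  exact ⟨C M, fun x => by simpa using hM x⟩

/-- A compactly supported approximation of the constant function `1`. -/
noncomputable def parabolicCutoff (n : ℕ) : C_c(ℝ, ℝ) where
  toFun x := max 0 (1 - x ^ 2 / (n + 1))
  continuous_toFun := by fun_prop
  hasCompactSupport' := by
    refine HasCompactSupport.intro (isCompact_Icc (a := -((n : ℝ) + 1)) (b := n + 1)) ?_
    intro x hx
    have hn : (0 : ℝ) ≤ n := n.cast_nonneg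
    refine max_eq_left ?_
    rw [sub_nonpos, one_le_div (by positivity)]
    by_contra! h
    exact hx (abs_le.mp (abs_le_of_sq_le_sq (by nlinarith) (by positivity)))

theorem parabolicCutoff_apply (n : ℕ) (x : ℝ) :
    parabolicCutoff n x = max 0 (1 - x ^ 2 / (n + 1)) := rfl

theorem parabolicCutoff_nonneg (n : ℕ) (x : ℝ) : 0 ≤ parabolicCutoff n x := le_max_left _ _

theorem parabolicCutoff_le_one (n : ℕ) (x : ℝ) : parabolicCutoff n x ≤ 1 :=
  max_le zero_le_one (sub_le_self _ (by positivity))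

theorem one_sub_parabolicCutoff_le (n : ℕ) (x : ℝ) :
    1 - parabolicCutoff n x ≤ x ^ 2 / (n + 1) := by
  have := le_max_right 0 (1 - x ^ 2 / ((n : ℝ) + 1))
  rw [parabolicCutoff_apply]
  linarith

theorem tendsto_parabolicCutoff (x : ℝ) :
    Tendsto (fun n => parabolicCutoff n x) atTop (𝓝 1) := by
  have h : Tendsto (fun n : ℕ => x ^ 2 / ((n : ℝ) + 1)) atTop (𝓝 0) :=
    tendsto_const_nhds.div_atTop
      (tendsto_atTop_add_const_right _ _ tendsto_natCast_atTop_atTop)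
  have h' : Tendsto (fun n : ℕ => 1 - x ^ 2 / ((n : ℝ) + 1)) atTop (𝓝 1) := by
    simpa using tendsto_const_nhds.sub h
  refine tendsto_of_tendsto_of_tendsto_of_le_of_le h' tendsto_const_nhds (fun n => ?_)
    fun n => parabolicCutoff_le_one n x
  have := one_sub_parabolicCutoff_le n x
  dsimp only
  linarith

/-- The product of a polynomial with `parabolicCutoff n`. -/
noncomputable def Polynomial.truncate (p : ℝ[X]) (n : ℕ) : C_c(ℝ, ℝ) where
  toFun x := parabolicCutoff n x * p.eval x
  continuous_toFun := by fun_prop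
  hasCompactSupport' := (parabolicCutoff n).hasCompactSupport.mul_right

theorem Polynomial.truncate_apply (p : ℝ[X]) (n : ℕ) (x : ℝ) :
    p.truncate n x = parabolicCutoff n x * p.eval x := rfl

/-- **Haviland's theorem** on the real line: a linear functional on polynomials which is
nonnegative on nonnegative polynomials is represented by a measure. -/
theorem exists_measure_integral_eval_eq (L : ℝ[X] →ₗ[ℝ] ℝ)
    (hL : ∀ p : ℝ[X], (∀ x, 0 ≤ p.eval x) → 0 ≤ L p) :
    ∃ μ : Measure ℝ, ∀ p : ℝ[X], Integrable (fun x => p.eval x) μ ∧ ∫ x, p.eval x ∂μ = L p := by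
  obtain ⟨G, hG, hpos⟩ := exists_positive_extension L hL
  have hmono : ∀ f g : polynomiallyBounded, (∀ x, (f : C(ℝ, ℝ)) x ≤ (g : C(ℝ, ℝ)) x) →
      G f ≤ G g := fun f g hfg => by
    have := hpos (g - f) fun x => by simpa using hfg x
    rwa [map_sub, sub_nonneg] at this
  let ι : C_c(ℝ, ℝ) → polynomiallyBounded :=
    fun f => ⟨f.toContinuousMap, f.toContinuousMap_mem_polynomiallyBounded⟩
  let Λ : C_c(ℝ, ℝ) →ₚ[ℝ] ℝ := PositiveLinearMap.mk₀
    { toFun := fun f => G (ι f)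
      map_add' := fun f g => (G.map_add (ι f) (ι g))
      map_smul' := fun c f => (G.map_smul c (ι f)) }
    fun f hf => hpos _ fun x => hf x
  let μ := RealRMK.rieszMeasure Λ
  have hμ : ∀ f : C_c(ℝ, ℝ), ∫ x, f x ∂μ = G (ι f) := fun f => RealRMK.integral_rieszMeasure Λ f
  have hint_trunc : ∀ (p : ℝ[X]) (n : ℕ), Integrable (p.truncate n) μ := fun p n =>
    (p.truncate n).continuous.integrable_of_hasCompactSupport (p.truncate n).hasCompactSupport
  have htend : ∀ (p : ℝ[X]) (x : ℝ), Tendsto (fun n => p.truncate n x) atTop (𝓝 (p.eval x)) :=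
    fun p x => by
      simpa [truncate_apply] using (tendsto_parabolicCutoff x).mul_const (p.eval x)
  have hint_nonneg : ∀ p : ℝ[X], (∀ x, 0 ≤ p.eval x) → Integrable (fun x => p.eval x) μ := by
    intro p hp
    refine ⟨p.continuous.aestronglyMeasurable, ?_⟩
    rw [hasFiniteIntegral_iff_ofReal (ae_of_all _ hp)]
    have hle : ∀ n, ∫⁻ x, ENNReal.ofReal (p.truncate n x) ∂μ ≤ ENNReal.ofReal (L p) := by
      intro n
      rw [← ofReal_integral_eq_lintegral_ofReal (hint_trunc p n)
        (ae_of_all _ fun x => mul_nonneg (parabolicCutoff_nonneg n x) (hp x)), hμ, ← hG]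
      exact ENNReal.ofReal_le_ofReal (hmono _ _ fun x =>
        mul_le_of_le_one_left (hp x) (parabolicCutoff_le_one n x))
    calc ∫⁻ x, ENNReal.ofReal (p.eval x) ∂μ
        = ∫⁻ x, liminf (fun n => ENNReal.ofReal (p.truncate n x)) atTop ∂μ :=
          lintegral_congr fun x =>
            ((ENNReal.continuous_ofReal.tendsto _).comp (htend p x)).liminf_eq.symm
      _ ≤ liminf (fun n => ∫⁻ x, ENNReal.ofReal (p.truncate n x) ∂μ) atTop :=
          lintegral_liminf_le fun n => (p.truncate n).continuous.measurable.ennreal_ofReal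
      _ ≤ ENNReal.ofReal (L p) := liminf_le_of_le (by isBoundedDefault) fun b hb =>
          let ⟨n, hn⟩ := hb.exists
          hn.trans (hle n)
      _ < ⊤ := ENNReal.ofReal_lt_top
  refine ⟨μ, fun p => ?_⟩
  have hint1 : Integrable (fun x => (1 + p * p).eval x) μ :=
    hint_nonneg _ fun x => (abs_nonneg _).trans (p.abs_eval_le x)
  refine ⟨hint1.mono' p.continuous.aestronglyMeasurable (ae_of_all _ p.abs_eval_le), ?_⟩
  have hlim : Tendsto (fun n => ∫ x, p.truncate n x ∂μ) atTop (𝓝 (∫ x, p.eval x ∂μ)) := by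
    refine tendsto_integral_of_dominated_convergence _
      (fun n => (hint_trunc p n).aestronglyMeasurable) hint1 (fun n => ae_of_all _ fun x => ?_)
      (ae_of_all _ (htend p))
    rw [truncate_apply, Real.norm_eq_abs, abs_mul, abs_of_nonneg (parabolicCutoff_nonneg n x)]
    exact (mul_le_of_le_one_left (abs_nonneg _) (parabolicCutoff_le_one n x)).trans
      (p.abs_eval_le x)
  refine tendsto_nhds_unique hlim ?_
  have hbound : ∀ n : ℕ,
      |(∫ x, p.truncate n x ∂μ) - L p| ≤ L (X ^ 2 * (1 + p * p)) / ((n : ℝ) + 1) := by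
    intro n
    have hpt : ∀ x, |p.eval x - p.truncate n x| ≤
        ((n : ℝ) + 1)⁻¹ * (X ^ 2 * (1 + p * p)).eval x := fun x => by
      have h1 := one_sub_parabolicCutoff_le n x
      have h0 : 0 ≤ 1 - parabolicCutoff n x := sub_nonneg.mpr (parabolicCutoff_le_one n x)
      calc |p.eval x - p.truncate n x| = (1 - parabolicCutoff n x) * |p.eval x| := by
            rw [truncate_apply, ← one_sub_mul, abs_mul, abs_of_nonneg h0]
        _ ≤ x ^ 2 / ((n : ℝ) + 1) * (1 + p * p).eval x :=
            mul_le_mul h1 (p.abs_eval_le x) (abs_nonneg _) (by positivity)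
        _ = _ := by rw [eval_mul, eval_pow, eval_X]; ring
    rw [hμ, ← hG, ← hG, abs_sub_comm, ← map_sub, div_eq_inv_mul, ← smul_eq_mul, ← map_smul,
      abs_le, ← map_neg]
    exact ⟨hmono _ _ fun x => (abs_le.mp (hpt x)).1, hmono _ _ fun x => (abs_le.mp (hpt x)).2⟩
  rw [tendsto_iff_dist_tendsto_zero]
  refine squeeze_zero (fun _ => dist_nonneg) hbound ?_
  exact tendsto_const_nhds.div_atTop
    (tendsto_atTop_add_const_right _ _ tendsto_natCast_atTop_atTop)

section ThreeTermRecurrence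

variable {P : ℕ → ℝ[X]} {a b : ℕ → ℝ}

theorem natDegree_of_three_term_recurrence (hP0 : P 0 = 1)
    (hmonic : ∀ n, (P n).Monic)
    (hrec : ∀ n, P (n + 1) = (X + C (a n)) * P n + C (b n) * P (n - 1)) (n : ℕ) :
    (P n).natDegree = n := by
  induction n using Nat.strong_induction_on with
  | h n ih =>
    match n, ih with
    | 0, _ => simp [hP0]
    | m + 1, ih =>
      have h1 : ((X + C (a m)) * P m).natDegree = m + 1 := by
        rw [(monic_X_add_C _).natDegree_mul (hmonic m), natDegree_X_add_C, ih m (by omega),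
          add_comm]
      have h2 : (C (b m) * P (m - 1)).natDegree < m + 1 :=
        (natDegree_C_mul_le _ _).trans_lt (by rw [ih (m - 1) (by omega)]; omega)
      rw [hrec, natDegree_add_eq_left_of_natDegree_lt (by rwa [h1]), h1]

theorem map_mul_of_three_term_recurrence (hb0 : b 0 = 0) (hP0 : P 0 = 1)
    (hrec : ∀ n, P (n + 1) = (X + C (a n)) * P n + C (b n) * P (n - 1))
    (L : ℝ[X] →ₗ[ℝ] ℝ) (hL : ∀ n, L (P n) = if 0 = n then 1 else 0) (m n : ℕ) :
    L (P m * P n) = if m = n then ∏ i ∈ Finset.range m, -b (i + 1) else 0 := by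
  induction m using Nat.strong_induction_on generalizing n with
  | h m ih =>
    match m, ih with
    | 0, _ => simp [hP0, hL]
    | m + 1, ih =>
      have key : P (m + 1) * P n = P m * P (n + 1) + (a m - a n) • (P m * P n) +
          b m • (P (m - 1) * P n) - b n • (P m * P (n - 1)) := by
        rw [hrec m, hrec n]
        simp only [smul_eq_C_mul, C_sub]
        ring
      rw [key]
      simp only [map_sub, map_add, map_smul, smul_eq_mul, ih m (by omega),
        ih (m - 1) (by omega)]
      clear key ih hrec hL hP0
      rcases m with _ | m <;> rcases n with _ | n <;>
        simp only [hb0, Finset.prod_range_succ, Finset.prod_range_zero, Nat.add_sub_cancel,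
          zero_mul] <;> grind

theorem map_mul_self_pos_of_orthogonal (B : Module.Basis ℕ ℝ ℝ[X]) (L : ℝ[X] →ₗ[ℝ] ℝ)
    (h : ℕ → ℝ) (hpos : ∀ n, 0 < h n)
    (hL : ∀ m n, L (B m * B n) = if m = n then h m else 0) {q : ℝ[X]} (hq : q ≠ 0) :
    0 < L (q * q) := by
  have hsum : L (q * q) = ∑ i ∈ (B.repr q).support, (B.repr q i) ^ 2 * h i := by
    conv_lhs => rw [← B.linearCombination_repr q, Finsupp.linearCombination_apply, Finsupp.sum]
    rw [Finset.sum_mul_sum]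
    simp only [map_sum, smul_mul_smul_comm, map_smul, hL, smul_eq_mul]
    refine Finset.sum_congr rfl fun i hi => ?_
    simp only [mul_ite, mul_zero, Finset.sum_ite_eq, if_pos hi, sq]
  rw [hsum]
  refine Finset.sum_pos (fun i hi => ?_) ?_
  · have := Finsupp.mem_support_iff.mp hi
    have := hpos i
    positivity
  · rw [Finsupp.support_nonempty_iff]
    simpa using hq

end ThreeTermRecurrence

/-- A linear functional on polynomials which is positive on nonzero squares is represented by a
measure with infinite support. -/
theorem exists_measure_infinite_support (L : ℝ[X] →ₗ[ℝ] ℝ)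
    (hL : ∀ q : ℝ[X], q ≠ 0 → 0 < L (q * q)) :
    ∃ μ : Measure ℝ, μ.support.Infinite ∧
      ∀ p : ℝ[X], Integrable (fun x => p.eval x) μ ∧ ∫ x, p.eval x ∂μ = L p := by
  have hsumSq : ∀ p : ℝ[X], IsSumSq p → 0 ≤ L p := fun p hp => by
    induction hp with
    | zero => simp
    | sq_add q _ ih =>
      rw [map_add]
      rcases eq_or_ne q 0 with rfl | hq
      · simpa using ih
      · exact add_nonneg (hL q hq).le ih
  obtain ⟨μ, hμ⟩ := exists_measure_integral_eval_eq L fun p hp =>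
    hsumSq p (p.isSumSq_of_eval_nonneg hp)
  refine ⟨μ, fun hfin => ?_, hμ⟩
  let q : ℝ[X] := ∏ x ∈ hfin.toFinset, (X - C x)
  have hq : q ≠ 0 := Finset.prod_ne_zero_iff.mpr fun x _ => X_sub_C_ne_zero x
  have hzero : ∫ x, (q * q).eval x ∂μ = 0 := by
    refine integral_eq_zero_of_ae ?_
    filter_upwards [μ.support_mem_ae] with x hx
    have : q.eval x = 0 := by
      rw [eval_prod]
      exact Finset.prod_eq_zero (hfin.mem_toFinset.mpr hx) (by simp)
    simp [this]
  rw [(hμ _).2] at hzero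
  exact (hL q hq).ne' hzero

/-- Favard-type theorem as anticipated by Meixner: monic polynomials `P_n` with `P_0 = 1`
satisfying a three-term recurrence `P_{n+1}(x) = (x + l_{n+1}) P_n(x) + k_{n+1} P_{n-1}(x)`
with all `k_{n+1} < 0` are orthogonal with respect to some nonzero finite Borel measure on
`ℝ` with infinite support, against which every polynomial is integrable. -/
theorem favard_orthogonality (P : ℕ → Polynomial ℝ) (hmonic : ∀ n, (P n).Monic)
    (hP0 : P 0 = 1)
    (l : ℕ → ℝ) (k : ℕ → ℝ) (hkneg : ∀ n : ℕ, 1 ≤ n → k (n + 1) < 0)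
    (hP1 : P 1 = X + C (l 1))
    (hrec : ∀ n : ℕ, 1 ≤ n →
      P (n + 1) = (X + C (l (n + 1))) * P n + C (k (n + 1)) * P (n - 1)) :
    ∃ μ : Measure ℝ, IsFiniteMeasure μ ∧ μ ≠ 0 ∧
      {x : ℝ | ∀ U ∈ nhds x, 0 < μ U}.Infinite ∧
      (∀ p : Polynomial ℝ, Integrable (fun x : ℝ => p.eval x) μ) ∧
      (∀ m n : ℕ, m ≠ n → ∫ x : ℝ, (P m).eval x * (P n).eval x ∂μ = 0) := by
  let a : ℕ → ℝ := fun n => l (n + 1)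
  let b : ℕ → ℝ := fun n => if n = 0 then 0 else k (n + 1)
  have hb0 : b 0 = 0 := if_pos rfl
  have hrec' : ∀ n, P (n + 1) = (X + C (a n)) * P n + C (b n) * P (n - 1) := by
    rintro (_ | n)
    · simp [hP0, hP1, a, hb0]
    · simpa [a, b] using hrec (n + 1) (by omega)
  let S : Polynomial.Sequence ℝ := ⟨P, fun n => by
    rw [degree_eq_natDegree (hmonic n).ne_zero,
      natDegree_of_three_term_recurrence hP0 hmonic hrec']⟩
  have hS : ∀ n, S n = P n := fun _ => rfl
  let B := S.basis fun n => by simp [hS, (hmonic n).leadingCoeff]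
  have hB : ∀ n, B n = P n := fun n => S.basis_eq_self _ n
  have hmul := map_mul_of_three_term_recurrence hb0 hP0 hrec' (B.coord 0) fun n => by
    rw [← hB, B.coord_apply, B.repr_self, Finsupp.single_apply]
    simp only [eq_comm]
  have hL : ∀ q : ℝ[X], q ≠ 0 → 0 < B.coord 0 (q * q) := fun q hq =>
    map_mul_self_pos_of_orthogonal B _ (fun m => ∏ i ∈ Finset.range m, -b (i + 1))
      (fun m => Finset.prod_pos fun i _ => by simpa [b] using hkneg (i + 1) (by omega))
      (by simpa only [hB] using hmul) hq
  obtain ⟨μ, hsupp, hμ⟩ := exists_measure_infinite_support _ hL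
  refine ⟨μ, ?_, ?_, ?_, fun p => (hμ p).1, fun m n hmn => ?_⟩
  · simpa [integrable_const_iff, isFiniteMeasure_iff] using (hμ 1).1
  · rintro rfl
    simp at hsupp
  · simpa only [← Measure.mem_support_iff_forall, Set.ofPred_mem_eq] using hsupp
  · simpa only [eval_mul, hmul, if_neg hmn] using (hμ (P m * P n)).2
end

section
/- Let \((a_k)_{k \ge 2}\) be real numbers, let T be the linear operator on real polynomials given by \(Tp = p' + \sum_{k \ge 2} a_k\, p^{(k)}\) and T' the linear operator given by \(T'p = p + \sum_{k \ge 2} k\, a_k\, p^{(k-1)}\) (finite sums for each polynomial p). Let \((P_n)_{n \ge 0}\) be monic real polynomials with \(\deg P_n = n\), \(P_0 = 1\), and \(T P_n = n\, P_{n-1}\) for all n ≥ 1, and suppose there are real numbers \(\lambda\), \(k_2\), \(\kappa\) such that \(P_1(x) = x\) and \(P_{n+1}(x) = (x + n\lambda) P_n(x) + n\,(k_2 + (n-1)\kappa)\, P_{n-1}(x)\) for all n ≥ 1. Then for every n ≥ 0, \((n+2)\, P_n(x) = (x + (n+1)\lambda)\, (T P_n)(x) + 2\,(T' P_n)(x)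 + (k_2 + n\kappa)\, (T(T P_n))(x)\). -/
open Polynomial

/-- The Pincherle derivative of `T = D + ∑_{k≥2} a_k D^k` is `1 + ∑_{k≥2} k a_k D^{k-1}`. -/
theorem pincherle_derivative_identity (a : ℕ → ℝ)
    (T T' : Polynomial ℝ → Polynomial ℝ)
    (hT : ∀ p : Polynomial ℝ,
      T p = Polynomial.derivative p +
        ∑ k ∈ Finset.Icc 2 p.natDegree, a k • (⇑(Polynomial.derivative (R := ℝ)))^[k] p)
    (hT' : ∀ p : Polynomial ℝ,
      T' p = p +
        ∑ k ∈ Finset.Icc 2 (p.natDegree + 1),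
          ((k : ℝ) * a k) • (⇑(Polynomial.derivative (R := ℝ)))^[k - 1] p)
    {p : Polynomial ℝ} (hp : p ≠ 0) : T (X * p) = X * T p + T' p := by
  have extend_range : ∑ k ∈ Finset.Icc 2 p.natDegree, a k • derivative^[k] p
      = ∑ k ∈ Finset.Icc 2 (p.natDegree + 1), a k • derivative^[k] p := by
    refine Finset.sum_subset (Finset.Icc_subset_Icc_right (Nat.le_succ _)) fun k hk hk' => ?_
    rw [iterate_derivative_eq_zero, smul_zero]
    simp only [Finset.mem_Icc] at hk hk'
    omega
  rw [hT, hT, hT', natDegree_X_mul hp, extend_range, derivative_mul, derivative_X, mul_add,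
    Finset.mul_sum]
  have summand_eq : ∀ k, a k • derivative^[k] (X * p)
      = X * (a k • derivative^[k] p) + ((k : ℝ) * a k) • derivative^[k - 1] p := by
    intro k
    rw [mul_comm X p, iterate_derivative_mul_X, mul_comm _ X, smul_add,
      mul_smul_comm, mul_comm (k : ℝ), mul_smul, Nat.cast_smul_eq_nsmul]
  simp only [summand_eq, Finset.sum_add_distrib]
  ring

/-- Meixner's second-order eigenvalue equation: with `T = D + ∑_{k≥2} a_k D^k` and
`T' = 1 + ∑_{k≥2} k a_k D^{k-1}`, for monic `P_n` satisfying the lowering property and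
the three-term recurrence `P_{n+1}(x) = (x + nλ) P_n(x) + n(k₂ + (n-1)κ) P_{n-1}(x)`,
one has `(n+2) P_n(x) = (x + (n+1)λ)(T P_n)(x) + 2 (T' P_n)(x) + (k₂ + nκ)(T² P_n)(x)`. -/
theorem meixner_second_order_equation (a : ℕ → ℝ)
    (T T' : Polynomial ℝ →ₗ[ℝ] Polynomial ℝ)
    (hT : ∀ p : Polynomial ℝ,
      T p = Polynomial.derivative p +
        ∑ k ∈ Finset.Icc 2 p.natDegree, a k • (⇑(Polynomial.derivative (R := ℝ)))^[k] p)
    (hT' : ∀ p : Polynomial ℝ,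
      T' p = p +
        ∑ k ∈ Finset.Icc 2 (p.natDegree + 1),
          ((k : ℝ) * a k) • (⇑(Polynomial.derivative (R := ℝ)))^[k - 1] p)
    (P : ℕ → Polynomial ℝ) (hmonic : ∀ n, (P n).Monic) (hdeg : ∀ n, (P n).natDegree = n)
    (hP0 : P 0 = 1)
    (hlow : ∀ n : ℕ, 1 ≤ n → T (P n) = (n : ℝ) • P (n - 1))
    (lam k₂ κ : ℝ)
    (hP1 : P 1 = X)
    (hrec : ∀ n : ℕ, 1 ≤ n →
      P (n + 1) = (X + C ((n : ℝ) * lam)) * P n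
        + C ((n : ℝ) * (k₂ + ((n : ℝ) - 1) * κ)) * P (n - 1)) :
    ∀ n : ℕ,
      ((n : ℝ) + 2) • P n
        = (X + C (((n : ℝ) + 1) * lam)) * T (P n)
          + (2 : ℝ) • T' (P n)
          + (k₂ + (n : ℝ) * κ) • T (T (P n)) := by
  intro n
  have comm (n : ℕ) : T (X * P n) = X * T (P n) + T' (P n) :=
    pincherle_derivative_identity a T T' hT hT' (hmonic n).ne_zero
  have hT_one : T 1 = 0 := by simp [hT]
  have lowered_recurrence (n : ℕ) (hn : 1 ≤ n) : ((n : ℝ) + 1) • P n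
      = X * T (P n) + T' (P n) + ((n : ℝ) * lam) • T (P n)
        + ((n : ℝ) * (k₂ + ((n : ℝ) - 1) * κ)) • T (P (n - 1)) := by
    have h := hlow (n + 1) (by omega)
    rw [hrec n hn, add_mul] at h
    simp only [← smul_eq_C_mul, map_add, map_smul, comm] at h
    simpa using h.symm
  match n with
  | 0 => simp [hP0, hT_one, hT', ofNat_smul_eq_nsmul]
  | 1 =>
    have h := lowered_recurrence 1 le_rfl
    have h1 := hlow 1 le_rfl
    simp only [Nat.sub_self, hP0, hP1, Nat.cast_one, one_smul, hT_one] at h h1 ⊢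
    rw [h1] at h ⊢
    rw [hT_one]
    simp only [smul_eq_C_mul, C_add, C_mul, C_1, C_ofNat] at h ⊢
    linear_combination 2 * h
  | m + 2 =>
    have h := lowered_recurrence (m + 2) (by omega)
    have h2 := hlow (m + 2) (by omega)
    have h1 := hlow (m + 1) (by omega)
    have hr := hrec (m + 1) (by omega)
    simp only [show m + 2 - 1 = m + 1 by omega, Nat.add_sub_cancel] at h h2 h1 hr
    rw [h2, h1] at h
    rw [h2, map_smul, h1]
    simp only [smul_eq_C_mul] at h ⊢
    push_cast at h hr ⊢
    simp only [C_add, C_mul, C_sub, C_1, C_ofNat] at h hr ⊢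
    linear_combination 2 * h - (C (m : ℝ) + 2) * hr
end

section
/- For every real a > 0, every natural number n, and every natural number x, \(\lim_{\beta \to \infty} M_n\big(x;\, \beta,\, \tfrac{a}{a+\beta}\big) = C_n(x;a)\), where the limit is taken over real \(\beta \to +\infty\). -/
open Nat Filter

/-- The Meixner polynomials
`M_n(x;β,c) = ∑_{k=0}^n (-n)_k (-x)_k / ((β)_k k!) · (1 - 1/c)^k`. -/
noncomputable def meixner (n : ℕ) (x : ℕ) (β c : ℝ) : ℝ :=
  ∑ k ∈ Finset.range (n + 1),
    poch (-(n : ℝ)) k * poch (-(x : ℝ)) k / (poch β k * (k ! : ℝ)) * (1 - 1 / c) ^ k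

theorem tendsto_pow_div_poch (k : ℕ) :
    Tendsto (fun β : ℝ => β ^ k / poch β k) atTop (nhds 1) := by
  have factor (j : ℕ) : Tendsto (fun β : ℝ => β / (β + (j : ℝ))) atTop (nhds 1) := by
    have h : Tendsto (fun β : ℝ => 1 - (j : ℝ) / (β + (j : ℝ))) atTop (nhds (1 - 0)) :=
      tendsto_const_nhds.sub
        ((tendsto_atTop_add_const_right atTop (j : ℝ) tendsto_id).const_div_atTop (j : ℝ))
    rw [sub_zero] at h
    refine h.congr' ?_
    filter_upwards [eventually_gt_atTop 0] with β hβ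
    have : β + (j : ℝ) ≠ 0 := by positivity
    field_simp
    ring
  have h := tendsto_finsetProd (Finset.range k) fun j _ => factor j
  simpa [poch, Finset.prod_div_distrib] using h

/-- Limit from the Meixner polynomials to the Charlier polynomials:
`lim_{β → ∞} M_n(x; β, a/(a+β)) = C_n(x;a)`. -/
theorem meixner_to_charlier_limit (a : ℝ) (ha : 0 < a) (n : ℕ) (x : ℕ) :
    Tendsto (fun β : ℝ => meixner n x β (a / (a + β))) atTop (nhds (charlier n x a)) := by
  unfold meixner charlier
  refine tendsto_finsetSum _ fun k _ => ?_
  have h := (tendsto_pow_div_poch k).const_mul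
    (poch (-(n : ℝ)) k * poch (-(x : ℝ)) k / (k ! : ℝ) * (-(1 / a)) ^ k)
  rw [mul_one] at h
  refine h.congr' ?_
  filter_upwards [eventually_gt_atTop 0] with β hβ
  have hc : 1 - 1 / (a / (a + β)) = -(1 / a) * β := by
    have : a + β ≠ 0 := by positivity
    field_simp
    ring
  rw [hc, mul_pow, div_mul_eq_div_div]
  ring
end
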